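/- arXiv:1806.04129 — 2 statements merged into one kernel-verified Lean document; each statement's English description precedes it below -/
import Mathlib

section
/- Let 0 < s < 1 and let k, n be positive integers with gcd(k,n) = 1. Then Δ_s⁻(k/n) = ((1−s)/s) · ∑_{ℓ=0}^∞ s^{⌊ℓn/k⌋} and Δ_s⁺(k/n) = s^{n−2}(1−s)²/(1−s^n) + ((1−s)/s) · ∑_{ℓ=0}^∞ s^{⌊ℓn/k⌋}. -/
open scoped BigOperators

/-- `Δ_s⁻(x) = ((1−s)/s)² · ∑_{j=1}^∞ s^j ⌈jx⌉`. -/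
noncomputable def DeltaMinus (s x : ℝ) : ℝ :=
  ((1 - s) / s) ^ 2 * ∑' j : ℕ, s ^ (j + 1) * ((⌈((j : ℝ) + 1) * x⌉ : ℤ) : ℝ)

/-- `Δ_s⁺(x) = (1−s)/s + ((1−s)/s)² · ∑_{j=1}^∞ s^j ⌊jx⌋`. -/
noncomputable def DeltaPlus (s x : ℝ) : ℝ :=
  (1 - s) / s + ((1 - s) / s) ^ 2 * ∑' j : ℕ, s ^ (j + 1) * ((⌊((j : ℝ) + 1) * x⌋ : ℤ) : ℝ)

theorem hasSum_geometric_tail {s : ℝ} (hs0 : 0 ≤ s) (hs1 : s < 1) (A : ℕ) :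
    HasSum (fun j : ℕ => if A ≤ j then s ^ (j + 1) else 0) (s ^ (A + 1) / (1 - s)) := by
  have hg := (hasSum_geometric_of_lt_one hs0 hs1).mul_left (s ^ (A + 1))
  rw [← div_eq_mul_inv] at hg
  refine ((add_left_injective A).hasSum_iff ?_).mp ?_
  · intro j hj
    rw [if_neg]
    intro h
    exact hj ⟨j - A, Nat.sub_add_cancel h⟩
  · refine hg.congr_fun fun j => ?_
    simp only [Function.comp, Nat.le_add_left, if_true]
    ring

theorem hasSum_geometric_multiples {s : ℝ} (hs0 : 0 ≤ s) (hs1 : s < 1) {n : ℕ} (hn : 0 < n) :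
    HasSum (fun j : ℕ => if n ∣ j + 1 then s ^ (j + 1) else 0) (s ^ n / (1 - s ^ n)) := by
  have hg := (hasSum_geometric_of_lt_one (pow_nonneg hs0 n)
    (pow_lt_one₀ hs0 hs1 hn.ne')).mul_left (s ^ n)
  rw [← div_eq_mul_inv] at hg
  have hpred : ∀ m : ℕ, n * (m + 1) - 1 + 1 = n * (m + 1) := fun m =>
    Nat.sub_add_cancel (Nat.mul_pos hn m.succ_pos)
  have hinj : Function.Injective (fun m : ℕ => n * (m + 1) - 1) := by
    intro a b hab
    have h : n * (a + 1) = n * (b + 1) := by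
      rw [← hpred a, ← hpred b]; exact congrArg (· + 1) hab
    have := Nat.eq_of_mul_eq_mul_left hn h
    omega
  refine (hinj.hasSum_iff ?_).mp ?_
  · intro j hj
    rw [if_neg]
    rintro ⟨m, hm⟩
    refine hj ⟨m - 1, ?_⟩
    have hm0 : 0 < m := Nat.pos_of_ne_zero (by rintro rfl; simp at hm)
    simp only [Nat.sub_add_cancel hm0, ← hm, Nat.add_sub_cancel]
  · refine hg.congr_fun fun m => ?_
    simp only [Function.comp, hpred, dvd_mul_right, if_true]
    rw [← pow_mul, ← pow_add]
    ring_nf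

theorem floor_div_le_iff_lt_ceil {x : ℝ} (hx : 0 < x) (l j : ℕ) :
    ⌊(l : ℝ) / x⌋₊ ≤ j ↔ l < ⌈((j : ℝ) + 1) * x⌉₊ := by
  rw [Nat.lt_ceil, ← Nat.lt_succ_iff, Nat.floor_lt (by positivity), div_lt_iff₀ hx]
  push_cast
  rfl

theorem summable_pow_mul_ceil {s : ℝ} (hs0 : 0 ≤ s) (hs1 : s < 1) {x : ℝ} (hx : 0 < x) :
    Summable (fun j : ℕ => s ^ (j + 1) * (⌈((j : ℝ) + 1) * x⌉₊ : ℝ)) := by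
  have h0 := summable_geometric_of_lt_one hs0 hs1
  have h1 := summable_pow_mul_geometric_of_norm_lt_one (R := ℝ) 1
    (r := s) (by rwa [Real.norm_of_nonneg hs0])
  refine Summable.of_nonneg_of_le (fun j => by positivity) (fun j => ?_)
    ((h1.mul_left (s * x)).add (h0.mul_left (s * (x + 1))))
  have hc := (Nat.ceil_lt_add_one (a := ((j : ℝ) + 1) * x) (by positivity)).le
  calc s ^ (j + 1) * (⌈((j : ℝ) + 1) * x⌉₊ : ℝ)
      ≤ s ^ (j + 1) * (((j : ℝ) + 1) * x + 1) := by gcongr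
    _ = _ := by ring

theorem tsum_pow_mul_ceil {s : ℝ} (hs0 : 0 ≤ s) (hs1 : s < 1) {x : ℝ} (hx : 0 < x) :
    ∑' j : ℕ, s ^ (j + 1) * (⌈((j : ℝ) + 1) * x⌉₊ : ℝ) =
      s / (1 - s) * ∑' l : ℕ, s ^ ⌊(l : ℝ) / x⌋₊ := by
  set F : ℕ → ℕ → ℝ := fun j l => if ⌊(l : ℝ) / x⌋₊ ≤ j then s ^ (j + 1) else 0 with hF
  have hrow : ∀ j, HasSum (F j) (s ^ (j + 1) * (⌈((j : ℝ) + 1) * x⌉₊ : ℝ)) := by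
    intro j
    have h := hasSum_sum_of_ne_finset_zero (f := F j) (L := .unconditional ℕ)
      (s := Finset.range ⌈((j : ℝ) + 1) * x⌉₊) (by
        intro l hl
        rw [Finset.mem_range, ← floor_div_le_iff_lt_ceil hx] at hl
        exact if_neg hl)
    rwa [Finset.sum_congr rfl (g := fun _ => s ^ (j + 1)) (by
        intro l hl
        rw [Finset.mem_range, ← floor_div_le_iff_lt_ceil hx] at hl
        exact if_pos hl), Finset.sum_const, Finset.card_range, nsmul_eq_mul, mul_comm] at h
  have hsum : Summable (Function.uncurry F) := by
    refine (summable_prod_of_nonneg ?_).mpr ⟨fun j => (hrow j).summable, ?_⟩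
    · rintro ⟨j, l⟩
      simp only [Function.uncurry, hF, Pi.zero_apply]
      positivity
    · simpa only [Function.uncurry, (hrow _).tsum_eq] using summable_pow_mul_ceil hs0 hs1 hx
  calc ∑' j : ℕ, s ^ (j + 1) * (⌈((j : ℝ) + 1) * x⌉₊ : ℝ)
      = ∑' j, ∑' l, F j l := tsum_congr fun j => (hrow j).tsum_eq.symm
    _ = ∑' l, ∑' j, F j l := hsum.tsum_comm.symm
    _ = ∑' l : ℕ, s / (1 - s) * s ^ ⌊(l : ℝ) / x⌋₊ := tsum_congr fun l => by
        rw [(hasSum_geometric_tail hs0 hs1 _).tsum_eq]; ring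
    _ = _ := tsum_mul_left

theorem floor_mul_div_eq_ceil {k n : ℕ} (hn : 0 < n) (hgcd : Nat.gcd k n = 1) (j : ℕ) :
    ⌊(j : ℝ) * ((k : ℝ) / n)⌋ =
      ⌈(j : ℝ) * ((k : ℝ) / n)⌉ - 1 + if n ∣ j then 1 else 0 := by
  have hn' : (n : ℝ) ≠ 0 := by positivity
  split_ifs with h
  · obtain ⟨m, rfl⟩ := h
    have : ((n * m : ℕ) : ℝ) * ((k : ℝ) / n) = ((m * k : ℕ) : ℝ) := by
      push_cast; field_simp
    rw [this, Int.floor_natCast, Int.ceil_natCast]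
    ring
  · have hy : (j : ℝ) * ((k : ℝ) / n) ∉ Set.range ((↑) : ℤ → ℝ) := by
      rintro ⟨z, hz⟩
      refine h (Nat.Coprime.dvd_of_dvd_mul_right (Nat.Coprime.symm hgcd) ?_)
      rw [← mul_div_assoc, eq_div_iff hn'] at hz
      have hz' : z * (n : ℤ) = j * k := by exact_mod_cast hz
      have hdvd : (n : ℤ) ∣ ((j * k : ℕ) : ℤ) := ⟨z, by push_cast; rw [← hz', mul_comm]⟩
      exact Int.natCast_dvd_natCast.mp hdvd
    rw [(Int.ceil_eq_floor_add_one_iff_notMem _).mpr hy]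
    ring

theorem stmt_7 (s : ℝ) (hs0 : 0 < s) (hs1 : s < 1) (k n : ℕ) (hk : 0 < k) (hn : 0 < n)
    (hgcd : Nat.gcd k n = 1) :
    DeltaMinus s ((k : ℝ) / (n : ℝ)) =
      (1 - s) / s * ∑' ℓ : ℕ, s ^ (⌊(ℓ : ℝ) * n / k⌋ : ℤ) ∧
    DeltaPlus s ((k : ℝ) / (n : ℝ)) =
      s ^ ((n : ℤ) - 2) * (1 - s) ^ 2 / (1 - s ^ n) +
        (1 - s) / s * ∑' ℓ : ℕ, s ^ (⌊(ℓ : ℝ) * n / k⌋ : ℤ) := by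
  have hs1' : 1 - s ≠ 0 := (sub_pos.mpr hs1).ne'
  have hx : 0 < (k : ℝ) / n := by positivity
  have hceil : ∀ j : ℕ, ((⌈((j : ℝ) + 1) * ((k : ℝ) / n)⌉ : ℤ) : ℝ) =
      (⌈((j : ℝ) + 1) * ((k : ℝ) / n)⌉₊ : ℝ) := fun j =>
    (natCast_ceil_eq_intCast_ceil (by positivity)).symm
  have hfloor : ∀ l : ℕ, s ^ (⌊(l : ℝ) * n / k⌋ : ℤ) = s ^ ⌊(l : ℝ) / ((k : ℝ) / n)⌋₊ := by
    intro l
    rw [div_div_eq_mul_div, ← Int.natCast_floor_eq_floor (by positivity), zpow_natCast]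
  have hminus : DeltaMinus s ((k : ℝ) / (n : ℝ)) =
      (1 - s) / s * ∑' ℓ : ℕ, s ^ (⌊(ℓ : ℝ) * n / k⌋ : ℤ) := by
    simp only [DeltaMinus, hceil, hfloor, tsum_pow_mul_ceil hs0.le hs1 hx]
    rw [← mul_assoc]
    congr 1
    field_simp
  refine ⟨hminus, ?_⟩
  have hceilSum := (summable_pow_mul_ceil hs0.le hs1 hx).hasSum
  have hone := hasSum_geometric_tail hs0.le hs1 0
  have hmul := hasSum_geometric_multiples hs0.le hs1 hn
  have hfloorSum := ((hceilSum.sub hone).add hmul).congr_fun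
    (g := fun j : ℕ => s ^ (j + 1) * ((⌊((j : ℝ) + 1) * ((k : ℝ) / n)⌋ : ℤ) : ℝ)) (by
      intro j
      have h := floor_mul_div_eq_ceil hn hgcd (j + 1)
      push_cast at h
      rw [h, ← hceil]
      push_cast
      simp only [Nat.zero_le, if_true]
      split_ifs <;> ring)
  rw [← hminus, DeltaPlus, DeltaMinus, hfloorSum.tsum_eq]
  simp only [hceil]
  generalize ∑' j : ℕ, s ^ (j + 1) * (⌈((j : ℝ) + 1) * ((k : ℝ) / n)⌉₊ : ℝ) = C
  have hsn : 1 - s ^ n ≠ 0 := (sub_pos.mpr (pow_lt_one₀ hs0.le hs1 hn.ne')).ne'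
  rw [zpow_sub₀ hs0.ne', zpow_natCast, zpow_ofNat]
  field_simp
  ring
end

section
/- Let 0 < s < 1 and let ξ > 0 be irrational. Then the set C_{s,ξ} (the closure in ℝ of the image of Υ_{s,ξ}⁺) has Lebesgue measure zero, is a perfect set, and is totally disconnected. -/
open scoped BigOperators

/-- `Υ_{s,ξ}⁻(x) = ((1−s)/s) · ∑_{j=1}^∞ s^j ⌈x − {jξ}⌉`. -/
noncomputable def UpsilonMinus (s ξ x : ℝ) : ℝ :=
  (1 - s) / s * ∑' j : ℕ, s ^ (j + 1) * ((⌈x - Int.fract (((j : ℝ) + 1) * ξ)⌉ : ℤ) : ℝ)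

/-- `Υ_{s,ξ}⁺(x) = 1 + ((1−s)/s) · ∑_{j=1}^∞ s^j ⌊x − {jξ}⌋`. -/
noncomputable def UpsilonPlus (s ξ x : ℝ) : ℝ :=
  1 + (1 - s) / s * ∑' j : ℕ, s ^ (j + 1) * ((⌊x - Int.fract (((j : ℝ) + 1) * ξ)⌋ : ℤ) : ℝ)

open Filter Topology MeasureTheory Pointwise

theorem Irrational.exists_nat_int_mem_Ioo {ξ : ℝ} (hξ : Irrational ξ) {x y : ℝ} (hxy : x < y) :
    ∃ (j : ℕ) (m : ℤ), ((j : ℝ) + 1) * ξ + m ∈ Set.Ioo x y := by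
  have hd : DenseRange (· • (ξ : AddCircle (1 : ℝ)) : ℕ → AddCircle (1 : ℝ)) := by
    rw [← denseRange_zsmul_iff_nsmul, AddCircle.denseRange_zsmul_coe_iff]
    simpa using hξ
  have ho : IsOpen ((fun t : ℝ => (t : AddCircle (1 : ℝ))) '' Set.Ioo (x - ξ) (y - ξ)) :=
    QuotientAddGroup.isOpenMap_coe _ isOpen_Ioo
  obtain ⟨n, t, ht, hnt⟩ := hd.exists_mem_open ho
    ((Set.nonempty_Ioo.2 (by linarith)).image _)
  have h0 : ((t - n * ξ : ℝ) : AddCircle (1 : ℝ)) = 0 := by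
    rw [← nsmul_eq_mul, AddCircle.coe_sub, AddCircle.coe_nsmul, sub_eq_zero]
    exact hnt
  obtain ⟨m, hm⟩ := (AddCircle.coe_eq_zero_iff (1 : ℝ)).1 h0
  rw [zsmul_one] at hm
  exact ⟨n, m, by constructor <;> linarith [ht.1, ht.2]⟩

theorem floor_sub_fract_lt_of_mem_Ioo {b x y : ℝ} {m : ℤ} (h : b + m ∈ Set.Ioo x y) :
    ⌊x - Int.fract b⌋ < ⌊y - Int.fract b⌋ := by
  have hb := Int.floor_add_fract b
  calc ⌊x - Int.fract b⌋ < m + ⌊b⌋ := by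
        rw [Int.floor_lt]; push_cast; linarith [h.1]
    _ ≤ ⌊y - Int.fract b⌋ := by
        rw [Int.le_floor]; push_cast; linarith [h.2]

theorem abs_floor_sub_le {x a : ℝ} (h0 : 0 ≤ a) (h1 : a < 1) : |(⌊x - a⌋ : ℝ)| ≤ |x| + 2 := by
  rw [abs_le]
  constructor <;> linarith [Int.floor_le (x - a), Int.lt_floor_add_one (x - a), neg_abs_le x,
    le_abs_self x]

theorem norm_pow_mul_floor_le {s : ℝ} (hs0 : 0 < s) (ξ : ℝ) {x C : ℝ} (hx : |x| ≤ C) (j : ℕ) :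
    ‖s ^ (j + 1) * (⌊x - Int.fract (((j : ℝ) + 1) * ξ)⌋ : ℝ)‖ ≤ s ^ (j + 1) * (C + 2) := by
  rw [norm_mul, Real.norm_of_nonneg (by positivity), Real.norm_eq_abs]
  gcongr
  exact (abs_floor_sub_le (Int.fract_nonneg _) (Int.fract_lt_one _)).trans (by linarith)

theorem summable_pow_succ_mul {s : ℝ} (hs0 : 0 < s) (hs1 : s < 1) (C : ℝ) :
    Summable fun j : ℕ => s ^ (j + 1) * C :=
  ((summable_nat_add_iff 1).2 (summable_geometric_of_lt_one hs0.le hs1)).mul_right C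

theorem summable_upsilonPlus {s : ℝ} (hs0 : 0 < s) (hs1 : s < 1) (ξ x : ℝ) :
    Summable fun j : ℕ => s ^ (j + 1) * (⌊x - Int.fract (((j : ℝ) + 1) * ξ)⌋ : ℝ) :=
  (summable_pow_succ_mul hs0 hs1 (|x| + 2)).of_norm_bounded
    (norm_pow_mul_floor_le hs0 ξ le_rfl)

theorem strictMono_upsilonPlus {s ξ : ℝ} (hs0 : 0 < s) (hs1 : s < 1) (hξ : Irrational ξ) :
    StrictMono (UpsilonPlus s ξ) := by
  intro x y hxy
  obtain ⟨j, m, hj⟩ := hξ.exists_nat_int_mem_Ioo hxy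
  have hc : 0 < (1 - s) / s := div_pos (by linarith) hs0
  refine add_lt_add_right (mul_lt_mul_of_pos_left ?_ hc) _
  refine Summable.tsum_lt_tsum (i := j) (fun k => ?_) ?_ (summable_upsilonPlus hs0 hs1 ξ x)
    (summable_upsilonPlus hs0 hs1 ξ y)
  · gcongr
  · exact mul_lt_mul_of_pos_left (by exact_mod_cast floor_sub_fract_lt_of_mem_Ioo hj)
      (by positivity)

theorem tendsto_floor_sub_nhdsGE (a x : ℝ) :
    Tendsto (fun y => (⌊y - a⌋ : ℝ)) (𝓝[≥] x) (𝓝 (⌊x - a⌋ : ℝ)) := by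
  have h : Tendsto (fun y => y - a) (𝓝[≥] x) (𝓝[≥] (x - a)) :=
    tendsto_nhdsWithin_iff.2 ⟨((continuous_sub_right a).tendsto x).mono_left nhdsWithin_le_nhds,
      eventually_mem_nhdsWithin.mono fun y (hy : x ≤ y) => sub_le_sub_right hy a⟩
  have h2 := (tendsto_floor_right_pure_floor (x - a)).comp h
  refine tendsto_const_nhds.congr' ?_
  filter_upwards [tendsto_pure.1 h2] with y hy
  exact congrArg Int.cast hy.symm

theorem tendsto_upsilonPlus_nhdsGE {s : ℝ} (hs0 : 0 < s) (hs1 : s < 1) (ξ x : ℝ) :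
    Tendsto (UpsilonPlus s ξ) (𝓝[≥] x) (𝓝 (UpsilonPlus s ξ x)) := by
  refine tendsto_const_nhds.add (tendsto_const_nhds.mul ?_)
  refine tendsto_tsum_of_dominated_convergence (summable_pow_succ_mul hs0 hs1 (|x| + 1 + 2))
    (fun j => tendsto_const_nhds.mul (tendsto_floor_sub_nhdsGE _ x)) ?_
  have h : ∀ᶠ y in 𝓝[≥] x, |y| < |x| + 1 :=
    nhdsWithin_le_nhds (continuous_abs.continuousAt.eventually_lt_const (by linarith))
  filter_upwards [h] with y hy
  exact norm_pow_mul_floor_le hs0 ξ hy.le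

theorem preperfect_range_upsilonPlus {s ξ : ℝ} (hs0 : 0 < s) (hs1 : s < 1) (hξ : Irrational ξ) :
    Preperfect (Set.range (UpsilonPlus s ξ)) := by
  rw [preperfect_iff_nhds]
  rintro _ ⟨x, rfl⟩ U hU
  have h : ∀ᶠ y in 𝓝[>] x, UpsilonPlus s ξ y ∈ U :=
    ((tendsto_upsilonPlus_nhdsGE hs0 hs1 ξ x).mono_left
      (nhdsWithin_mono x Set.Ioi_subset_Ici_self)).eventually hU
  obtain ⟨y, hyU, hxy⟩ := (h.and eventually_mem_nhdsWithin).exists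
  exact ⟨_, ⟨hyU, y, rfl⟩, (strictMono_upsilonPlus hs0 hs1 hξ hxy).ne'⟩

/-- The purely atomic distribution function with mass `(1 - s) * s ^ j` at the point `a j`. -/
noncomputable def geometricJumpFunction (s : ℝ) (a : ℕ → ℝ) (t : ℝ) : ℝ :=
  ∑' j : ℕ, (1 - s) * s ^ j * (if a j ≤ t then 1 else 0)

theorem hasSum_geometric_weights {s : ℝ} (hs0 : 0 < s) (hs1 : s < 1) :
    HasSum (fun j : ℕ => (1 - s) * s ^ j) 1 := by
  have h := (hasSum_geometric_of_lt_one hs0.le hs1).mul_left (1 - s)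
  rwa [mul_inv_cancel₀ (by linarith)] at h

theorem summable_geometricJumpFunction {s : ℝ} (hs0 : 0 < s) (hs1 : s < 1) (a : ℕ → ℝ) (t : ℝ) :
    Summable fun j : ℕ => (1 - s) * s ^ j * (if a j ≤ t then (1 : ℝ) else 0) := by
  have hs : 0 < 1 - s := by linarith
  refine .of_nonneg_of_le (fun j => by positivity) (fun j => ?_)
    (hasSum_geometric_weights hs0 hs1).summable
  exact mul_le_of_le_one_right (by positivity) (by split_ifs <;> norm_num)

theorem geometricJumpFunction_mem_Icc {s : ℝ} (hs0 : 0 < s) (hs1 : s < 1) (a : ℕ → ℝ) (t : ℝ) :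
    geometricJumpFunction s a t ∈ Set.Icc 0 1 := by
  have hs : 0 < 1 - s := by linarith
  refine ⟨tsum_nonneg fun j => by positivity, ?_⟩
  rw [← (hasSum_geometric_weights hs0 hs1).tsum_eq]
  refine (summable_geometricJumpFunction hs0 hs1 a t).tsum_le_tsum (fun j => ?_)
    (hasSum_geometric_weights hs0 hs1).summable
  exact mul_le_of_le_one_right (by positivity) (by split_ifs <;> norm_num)

theorem geometricJumpFunction_eq_sum_add {s : ℝ} (hs0 : 0 < s) (hs1 : s < 1) (a : ℕ → ℝ)
    (N : ℕ) (t : ℝ) :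
    geometricJumpFunction s a t =
      ∑ j ∈ (Finset.range N).filter (fun j => a j ≤ t), (1 - s) * s ^ j +
        s ^ N * geometricJumpFunction s (fun j => a (j + N)) t := by
  rw [geometricJumpFunction, geometricJumpFunction,
    ← (summable_geometricJumpFunction hs0 hs1 a t).sum_add_tsum_nat_add N, ← tsum_mul_left,
    Finset.sum_filter]
  congr 1
  · exact Finset.sum_congr rfl fun j _ => by split_ifs <;> simp
  · exact tsum_congr fun j => by ring

theorem filter_le_eq_of_card_eq {ι : Type*} (S : Finset ι) (a : ι → ℝ) {t u : ℝ}
    (h : (S.filter (fun j => a j ≤ t)).card = (S.filter (fun j => a j ≤ u)).card) :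
    S.filter (fun j => a j ≤ t) = S.filter (fun j => a j ≤ u) := by
  wlog htu : t ≤ u generalizing t u
  · exact (this h.symm (le_of_not_ge htu)).symm
  · exact Finset.eq_of_subset_of_card_le
      (Finset.monotone_filter_right S fun j _ hj => le_trans hj htu) h.ge

theorem exists_range_geometricJumpFunction_subset {s : ℝ} (hs0 : 0 < s) (hs1 : s < 1)
    (a : ℕ → ℝ) (N : ℕ) :
    ∃ v : ℕ → ℝ, Set.range (geometricJumpFunction s a) ⊆
      ⋃ k ∈ Finset.range (N + 1), Set.Icc (v k) (v k + s ^ N) := by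
  let c : ℝ → ℕ := fun t => ((Finset.range N).filter (fun j => a j ≤ t)).card
  let p : ℝ → ℝ := fun t => ∑ j ∈ (Finset.range N).filter (fun j => a j ≤ t), (1 - s) * s ^ j
  have hf : Function.FactorsThrough p c := fun t u h => by
    simp only [p, filter_le_eq_of_card_eq _ a h]
  refine ⟨Function.extend c p 0, ?_⟩
  rintro _ ⟨t, rfl⟩
  refine Set.mem_biUnion (x := c t) ?_ ?_
  · have : c t ≤ N := (Finset.card_filter_le _ _).trans_eq (Finset.card_range N)
    simpa using Nat.lt_succ_of_le this
  · rw [hf.extend_apply, geometricJumpFunction_eq_sum_add hs0 hs1 a N t]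
    have h := geometricJumpFunction_mem_Icc hs0 hs1 (fun j => a (j + N)) t
    have hN : 0 < s ^ N := by positivity
    constructor
    · exact le_add_of_nonneg_right (mul_nonneg hN.le h.1)
    · exact add_le_add_right (mul_le_of_le_one_right hN.le h.2) _

theorem volume_closure_range_geometricJumpFunction {s : ℝ} (hs0 : 0 < s) (hs1 : s < 1)
    (a : ℕ → ℝ) : volume (closure (Set.range (geometricJumpFunction s a))) = 0 := by
  have hle (N : ℕ) : volume (closure (Set.range (geometricJumpFunction s a))) ≤
      ENNReal.ofReal ((N + 1 : ℝ) * s ^ N) := by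
    obtain ⟨v, hv⟩ := exists_range_geometricJumpFunction_subset hs0 hs1 a N
    calc volume (closure (Set.range (geometricJumpFunction s a)))
        ≤ volume (⋃ k ∈ Finset.range (N + 1), Set.Icc (v k) (v k + s ^ N)) :=
          measure_mono (closure_minimal hv
            ((Finset.range (N + 1)).finite_toSet.isClosed_biUnion fun _ _ => isClosed_Icc))
      _ ≤ ∑ k ∈ Finset.range (N + 1), volume (Set.Icc (v k) (v k + s ^ N)) :=
          measure_biUnion_finset_le _ _
      _ = ENNReal.ofReal ((N + 1 : ℝ) * s ^ N) := by
          simp only [Real.volume_Icc, add_sub_cancel_left, Finset.sum_const, Finset.card_range,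
            nsmul_eq_mul]
          rw [ENNReal.ofReal_mul (by positivity)]
          norm_cast
  have hlim : Tendsto (fun N : ℕ => ENNReal.ofReal ((N + 1 : ℝ) * s ^ N)) atTop (𝓝 0) := by
    have h := (tendsto_self_mul_const_pow_of_lt_one hs0.le hs1).add
      (tendsto_pow_atTop_nhds_zero_of_lt_one hs0.le hs1)
    rw [← ENNReal.ofReal_zero, ← add_zero (0 : ℝ)]
    refine ENNReal.tendsto_ofReal (h.congr fun N => by ring)
  exact le_antisymm (ge_of_tendsto' hlim hle) zero_le

theorem floor_sub_eq_add_ite {x a : ℝ} (h0 : 0 ≤ a) (h1 : a < 1) :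
    (⌊x - a⌋ : ℝ) = ⌊x⌋ - 1 + if a ≤ Int.fract x then 1 else 0 := by
  have hx := Int.floor_add_fract x
  have := Int.fract_lt_one x
  have := Int.fract_nonneg x
  split_ifs with h
  · have : ⌊x - a⌋ = ⌊x⌋ := by rw [Int.floor_eq_iff]; constructor <;> linarith
    rw [this]; ring
  · have : ⌊x - a⌋ = ⌊x⌋ - 1 := by
      rw [Int.floor_eq_iff]; push_cast; constructor <;> linarith
    rw [this]; push_cast; ring

theorem upsilonPlus_eq_floor_add {s : ℝ} (hs0 : 0 < s) (hs1 : s < 1) (ξ x : ℝ) :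
    UpsilonPlus s ξ x = ⌊x⌋ +
      geometricJumpFunction s (fun j => Int.fract (((j : ℝ) + 1) * ξ)) (Int.fract x) := by
  have h := ((hasSum_geometric_weights hs0 hs1).mul_right ((⌊x⌋ : ℝ) - 1)).add
    (summable_geometricJumpFunction hs0 hs1 (fun j => Int.fract (((j : ℝ) + 1) * ξ))
      (Int.fract x)).hasSum
  have h' : (1 - s) / s * ∑' j : ℕ, s ^ (j + 1) * (⌊x - Int.fract (((j : ℝ) + 1) * ξ)⌋ : ℝ) =
      1 * ((⌊x⌋ : ℝ) - 1) +
        geometricJumpFunction s (fun j => Int.fract (((j : ℝ) + 1) * ξ)) (Int.fract x) := by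
    rw [← tsum_mul_left, geometricJumpFunction, ← h.tsum_eq]
    refine tsum_congr fun j => ?_
    rw [floor_sub_eq_add_ite (Int.fract_nonneg _) (Int.fract_lt_one _), pow_succ]
    field_simp
  rw [UpsilonPlus, h']
  ring

theorem volume_closure_range_upsilonPlus {s : ℝ} (hs0 : 0 < s) (hs1 : s < 1) (ξ : ℝ) :
    volume (closure (Set.range (UpsilonPlus s ξ))) = 0 := by
  let a : ℕ → ℝ := fun j => Int.fract (((j : ℝ) + 1) * ξ)
  let K := closure (Set.range (geometricJumpFunction s a))
  have hK : IsCompact K := isCompact_Icc.of_isClosed_subset isClosed_closure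
    (closure_minimal (Set.range_subset_iff.2 (geometricJumpFunction_mem_Icc hs0 hs1 a))
      isClosed_Icc)
  have hsub : closure (Set.range (UpsilonPlus s ξ)) ⊆ Set.range ((↑) : ℤ → ℝ) + K := by
    refine closure_minimal ?_
      (Int.isClosedEmbedding_coe_real.isClosed_range.add_right_of_isCompact hK)
    rintro _ ⟨x, rfl⟩
    rw [upsilonPlus_eq_floor_add hs0 hs1]
    exact Set.add_mem_add ⟨_, rfl⟩ (subset_closure ⟨_, rfl⟩)
  refine measure_mono_null hsub ?_
  rw [← Set.iUnion_add_left_image]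
  refine (measure_biUnion_null_iff (Set.countable_range _)).2 fun r _ => ?_
  rw [Set.image_add_left, measure_preimage_add]
  exact volume_closure_range_geometricJumpFunction hs0 hs1 a

theorem isTotallyDisconnected_of_volume_eq_zero {S : Set ℝ} (hS : volume S = 0) :
    IsTotallyDisconnected S := by
  intro T hTS hT x hx y hy
  by_contra hne
  wlog hxy : x < y generalizing x y
  · exact this hy hx (Ne.symm hne) (lt_of_le_of_ne (not_lt.1 hxy) (Ne.symm hne))
  have h := measure_mono_null ((hT.Icc_subset hx hy).trans hTS) hS
  rw [Real.volume_Icc, ENNReal.ofReal_eq_zero] at h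
  linarith

theorem stmt_13 (s ξ : ℝ) (hs0 : 0 < s) (hs1 : s < 1) (hξ : 0 < ξ)
    (hirr : Irrational ξ) :
    MeasureTheory.volume (closure (Set.range (UpsilonPlus s ξ))) = 0 ∧
    Perfect (closure (Set.range (UpsilonPlus s ξ))) ∧
    IsTotallyDisconnected (closure (Set.range (UpsilonPlus s ξ))) := by
  have h := volume_closure_range_upsilonPlus hs0 hs1 ξ
  exact ⟨h, (preperfect_range_upsilonPlus hs0 hs1 hirr).perfect_closure,
    isTotallyDisconnected_of_volume_eq_zero h⟩
end
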